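/- Let r ≥ 3 and 2 ≤ q ≤ C(r,2), and write C(r,2) = a·q + b with integers a, b satisfying 0 ≤ b < q. If b = 0 or r + b ≥ q, then there are infinitely many integers n divisible by r for which there exists an n-vertex graph G with minimum degree δ(G) = (r/(r+1))·n and a q-edge-coloring f : E(G) → {1,…,q} such that every K_r-tiling of G has discrepancy 0 with respect to f; that is, in every K_r-tiling of G every color appears on exactly e(T)/q of the edges of the tiling T. (Combined with the general upper bound δ_{r,q} ≤ r/(r+1), this shows δ_{r,q} = r/(r+1) under this arithmetic condition.) -/

import Mathlib

open Finset

variable {V : Type*}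

/-- A `Kᵣ`-tiling of the vertex set `W`: a collection of pairwise-disjoint `r`-cliques of `G`
whose union is `W`. -/
def IsKrTilingOn [DecidableEq V] (G : SimpleGraph V) (r : ℕ)
    (T : Finset (Finset V)) (W : Finset V) : Prop :=
  (∀ K ∈ T, G.IsNClique r K) ∧
  (∀ K ∈ T, ∀ K' ∈ T, K ≠ K' → Disjoint K K') ∧
  T.biUnion id = W

/-- A perfect `Kᵣ`-tiling of `G`. -/
def IsKrTiling [Fintype V] [DecidableEq V] (G : SimpleGraph V) (r : ℕ)
    (T : Finset (Finset V)) : Prop :=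
  IsKrTilingOn G r T Finset.univ

/-- The number of edges of color `c` lying inside the cliques of `T`. -/
def tilingColorCount [DecidableEq V] {q : ℕ} (f : Sym2 V → Fin q)
    (T : Finset (Finset V)) (c : Fin q) : ℕ :=
  ∑ K ∈ T, (K.sym2.filter fun e => ¬ e.IsDiag ∧ f e = c).card

/-- The total number of edges lying inside the cliques of `T`. -/
def tilingEdgeCount [DecidableEq V] (T : Finset (Finset V)) : ℕ :=
  ∑ K ∈ T, (K.sym2.filter fun e => ¬ e.IsDiag).card


lemma aux_exists_fibers {α : Type*} {q : ℕ} (hq : 0 < q) (S : Finset α) (w : Fin q → ℕ)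
    (hw : S.card = ∑ c, w c) :
    ∃ g : α → Fin q, ∀ c, (S.filter fun x => g x = c).card = w c := by
  classical
  have hcard : Fintype.card S = Fintype.card (Σ c : Fin q, Fin (w c)) := by
    simp [hw]
  let e := Fintype.equivOfCardEq hcard
  refine ⟨fun x => if hx : x ∈ S then (e ⟨x, hx⟩).1 else ⟨0, hq⟩, fun c => ?_⟩
  rw [← Fintype.card_fin (w c), ← Finset.card_univ]
  symm
  refine Finset.card_bij (fun i _ => ((e.symm ⟨c, i⟩ : S) : α)) ?_ ?_ ?_
  · intro i _
    simp
  · intro i _ j _ hij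
    have := e.symm.injective (Subtype.ext hij)
    simpa using this
  · intro x hx
    simp only [mem_filter] at hx
    obtain ⟨hxS, hx2⟩ := hx
    rw [dif_pos hxS] at hx2
    subst hx2
    exact ⟨(e ⟨x, hxS⟩).2, mem_univ _, by simp⟩

lemma aux_card_nondiag {α : Type*} [DecidableEq α] (s : Finset α) :
    (s.sym2.filter fun e => ¬ e.IsDiag).card = s.card.choose 2 := by
  rw [← Sym2.card_image_offDiag]
  congr 1
  ext e
  induction e with
  | _ a b =>
    simp only [mem_filter, mk_mem_sym2_iff, Sym2.mk_isDiag_iff, mem_image, mem_offDiag, Prod.exists,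
      Function.uncurry_apply_pair, Sym2.eq_iff]
    constructor
    · rintro ⟨⟨h1, h2⟩, h3⟩
      exact ⟨a, b, ⟨h1, h2, h3⟩, Or.inl ⟨rfl, rfl⟩⟩
    · rintro ⟨x, y, ⟨h1, h2, h3⟩, ⟨rfl, rfl⟩ | ⟨rfl, rfl⟩⟩
      · exact ⟨⟨h1, h2⟩, h3⟩
      · exact ⟨⟨h2, h1⟩, Ne.symm h3⟩

/-- Edges of colour `c` in a clique touching part `0`. -/
lemma aux_cliqueA [DecidableEq V] {r q : ℕ} (p : V → Fin (r + 1))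
    [DecidablePred fun e : Sym2 V => ∃ u ∈ e, p u = 0] (g : V → Fin q)
    (f : Sym2 V → Fin q)
    (hf0 : ∀ u v, p u = 0 → p v ≠ 0 → f s(u, v) = g u)
    (K : Finset V) (hK : K.card = r) (hinj : Set.InjOn p K) (c : Fin q) :
    (K.sym2.filter fun e => (¬ e.IsDiag ∧ f e = c) ∧ ∃ u ∈ e, p u = 0).card
      = ∑ v ∈ K, if p v = 0 ∧ g v = c then (r - 1) else 0 := by
  classical
  rw [← Finset.sum_filter]
  have hset : (K.sym2.filter fun e => (¬ e.IsDiag ∧ f e = c) ∧ ∃ u ∈ e, p u = 0)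
      = (K.filter fun v => p v = 0 ∧ g v = c).biUnion
        (fun v => (K.erase v).image (fun w => s(v, w))) := by
    have key : ∀ x y, x ∈ K → y ∈ K → x ≠ y → p x = 0 → f s(x, y) = g x := by
      intro x y hx hy hxy h0
      refine hf0 x y h0 fun h => hxy (hinj hx hy (h0.trans h.symm))
    ext e
    simp only [mem_filter, mem_biUnion, mem_image, mem_erase, mem_sym2_iff]
    constructor
    · rintro ⟨hsub, ⟨hd, hc⟩, u, hu, hu0⟩
      obtain ⟨w, rfl⟩ := Sym2.mem_iff_exists.mp hu
      have huK : u ∈ K := hsub u (by simp)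
      have hwK : w ∈ K := hsub w (by simp)
      have huw : u ≠ w := by simpa using hd
      exact ⟨u, ⟨huK, hu0, by rw [← key u w huK hwK huw hu0]; exact hc⟩, w, ⟨huw.symm, hwK⟩, rfl⟩
    · rintro ⟨u, ⟨huK, hu0, hgc⟩, w, ⟨hwu, hwK⟩, rfl⟩
      refine ⟨?_, ⟨by simpa using hwu.symm, by rw [key u w huK hwK hwu.symm hu0]; exact hgc⟩,
        u, by simp, hu0⟩
      intro a ha
      rcases Sym2.mem_iff.mp ha with rfl | rfl <;> assumption
  rw [hset, Finset.card_biUnion]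
  · refine Finset.sum_congr rfl fun v hv => ?_
    rw [Finset.card_image_of_injective _ (fun a b h => Sym2.congr_right.mp h),
      Finset.card_erase_of_mem (mem_filter.mp hv).1, hK]
  · intro x hx y hy hxy
    have hx := mem_filter.mp hx
    have hy := mem_filter.mp hy
    exact absurd (hinj hx.1 hy.1 (hx.2.1.trans hy.2.1.symm)) hxy

/-- Edges of colour `c` in a clique avoiding part `0`. -/
lemma aux_cliqueB [DecidableEq V] {r q : ℕ} (p : V → Fin (r + 1))
    [DecidablePred fun e : Sym2 V => ∃ u ∈ e, p u = 0]
    (h : Sym2 (Fin (r + 1)) → Fin q) (f : Sym2 V → Fin q)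
    (hf1 : ∀ u v, p u ≠ 0 → p v ≠ 0 → f s(u, v) = h s(p u, p v))
    (K : Finset V) (hinj : Set.InjOn p K) (c : Fin q) :
    (K.sym2.filter fun e => (¬ e.IsDiag ∧ f e = c) ∧ ¬ ∃ u ∈ e, p u = 0).card
      = ∑ d ∈ (((univ : Finset (Fin (r + 1))).erase 0).sym2.filter fun d => ¬ d.IsDiag).filter
          (fun d => h d = c), if d ∈ (K.image p).sym2 then 1 else 0 := by
  classical
  rw [← Finset.sum_filter, ← Finset.card_eq_sum_ones]
  refine Finset.card_bij (fun e _ => e.map p) ?_ ?_ ?_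
  · intro e
    induction e with
    | _ x y =>
      intro he
      simp only [mem_filter, mk_mem_sym2_iff, Sym2.mk_isDiag_iff, Sym2.mem_iff, exists_eq_or_imp,
        exists_eq_left, not_or] at he
      obtain ⟨⟨hx, hy⟩, ⟨hxy, hc⟩, hx0, hy0⟩ := he
      simp only [Sym2.map_mk, mem_filter, mk_mem_sym2_iff, mem_erase, mem_univ,
        Sym2.mk_isDiag_iff, and_true]
      exact ⟨⟨⟨⟨hx0, hy0⟩, fun hh => hxy (hinj hx hy hh)⟩, by rw [← hf1 x y hx0 hy0]; exact hc⟩,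
        mem_image_of_mem _ hx, mem_image_of_mem _ hy⟩
  · intro e he e' he' hee
    induction e with
    | _ x y =>
    induction e' with
    | _ x' y' =>
      simp only [mem_filter, mk_mem_sym2_iff] at he he'
      obtain ⟨⟨hx, hy⟩, -⟩ := he
      obtain ⟨⟨hx', hy'⟩, -⟩ := he'
      simp only [Sym2.map_mk, Sym2.eq_iff] at hee ⊢
      rcases hee with ⟨h1, h2⟩ | ⟨h1, h2⟩
      · exact Or.inl ⟨hinj hx hx' h1, hinj hy hy' h2⟩
      · exact Or.inr ⟨hinj hx hy' h1, hinj hy hx' h2⟩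
  · intro d
    induction d with
    | _ i j =>
      intro hd
      simp only [mem_filter, mk_mem_sym2_iff, mem_erase, mem_univ,
        Sym2.mk_isDiag_iff, and_true, mem_image] at hd
      obtain ⟨⟨⟨⟨hi0, hj0⟩, hij⟩, hc⟩, ⟨x, hx, rfl⟩, ⟨y, hy, rfl⟩⟩ := hd
      refine ⟨s(x, y), ?_, rfl⟩
      simp only [mem_filter, mk_mem_sym2_iff, Sym2.mk_isDiag_iff, Sym2.mem_iff, exists_eq_or_imp,
        exists_eq_left, not_or]
      exact ⟨⟨hx, hy⟩, ⟨fun hh => hij (by rw [hh]), by rw [hf1 x y hi0 hj0]; exact hc⟩, hi0, hj0⟩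

/-- Counting cliques of the tiling meeting two given parts. -/
lemma aux_pairs {α : Type*} {r : ℕ} (T : Finset α) (P : α → Finset (Fin (r + 1)))
    (hP : ∀ K ∈ T, (P K).card = r) (m : ℕ)
    (hm : ∀ i, (T.filter fun K => i ∈ P K).card = m) (i j : Fin (r + 1)) (hij : i ≠ j) :
    (T.filter fun K => i ∈ P K ∧ j ∈ P K).card + T.card = 2 * m := by
  classical
  have h1 : (T.filter fun K => i ∈ P K ∨ j ∈ P K) = T := by
    refine Finset.filter_true_of_mem fun K hK => ?_
    by_contra hcon
    push Not at hcon
    have hsub : P K ⊆ (univ.erase i).erase j := by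
      intro x hx
      simp only [mem_erase, mem_univ, and_true]
      exact ⟨fun h => hcon.2 (h ▸ hx), fun h => hcon.1 (h ▸ hx)⟩
    have := Finset.card_le_card hsub
    rw [hP K hK, Finset.card_erase_of_mem (by simp [hij.symm]),
      Finset.card_erase_of_mem (mem_univ _), Finset.card_univ, Fintype.card_fin] at this
    have : 0 < r := by
      rcases Nat.eq_zero_or_pos r with h | h
      · subst h
        exact absurd (Fin.ext (by omega)) hij
      · exact h
    omega
  have h2 := Finset.card_union_add_card_inter (T.filter fun K => i ∈ P K) (T.filter fun K => j ∈ P K)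
  rw [← Finset.filter_or, ← Finset.filter_and, h1, hm, hm] at h2
  omega

lemma aux_sum_tiling [Fintype V] [DecidableEq V] {G : SimpleGraph V} {r : ℕ}
    {T : Finset (Finset V)} (hT : IsKrTiling G r T) (F : V → ℕ) :
    ∑ K ∈ T, ∑ v ∈ K, F v = ∑ v, F v := by
  obtain ⟨-, h2, h3⟩ := hT
  rw [← h3, Finset.sum_biUnion]
  · rfl
  · intro K hK K' hK' hne
    exact h2 K hK K' hK' hne

lemma aux_count [Fintype V] [DecidableEq V] {r q k : ℕ} (hr : 0 < r) (p : V → Fin (r + 1))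
    (hp : ∀ i, (univ.filter fun v => p v = i).card = r * q * k)
    (G : SimpleGraph V) (hG : ∀ u v, G.Adj u v → p u ≠ p v)
    (g : V → Fin q) (h : Sym2 (Fin (r + 1)) → Fin q) (f : Sym2 V → Fin q)
    (hf0 : ∀ u v, p u = 0 → p v ≠ 0 → f s(u, v) = g u)
    (hf1 : ∀ u v, p u ≠ 0 → p v ≠ 0 → f s(u, v) = h s(p u, p v))
    (T : Finset (Finset V)) (hT : IsKrTiling G r T) (c : Fin q) :
    tilingColorCount f T c =
      (univ.filter fun v => p v = 0 ∧ g v = c).card * (r - 1) +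
      ((((univ : Finset (Fin (r + 1))).erase 0).sym2.filter fun d => ¬ d.IsDiag).filter
          (fun d => h d = c)).card * ((r - 1) * q * k) := by
  classical
  have hinj : ∀ K ∈ T, Set.InjOn p K := by
    intro K hK x hx y hy hxy
    by_contra hne
    exact hG x y ((hT.1 K hK).isClique hx hy hne) hxy
  have hcard : ∀ K ∈ T, K.card = r := fun K hK => (hT.1 K hK).card_eq
  have himg : ∀ K ∈ T, (K.image p).card = r := fun K hK => by
    rw [Finset.card_image_of_injOn (hinj K hK), hcard K hK]
  -- number of cliques
  have hTcard : T.card = (r + 1) * q * k := by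
    have h1 := aux_sum_tiling hT (fun _ => 1)
    have h2 : ∑ K ∈ T, ∑ v ∈ K, 1 = T.card * r := by
      rw [Finset.sum_congr rfl (fun K hK => by rw [← Finset.card_eq_sum_ones, hcard K hK])]
      simp
    have h3 : ∑ v : V, 1 = (r + 1) * (r * q * k) := by
      rw [← Finset.card_eq_sum_ones, Finset.card_eq_sum_card_fiberwise (f := p) (t := univ) (by simp)]
      simp [hp]
    rw [h2, h3] at h1
    apply Nat.eq_of_mul_eq_mul_right hr
    rw [h1]; ring
  have hmeet : ∀ i, (T.filter fun K => i ∈ K.image p).card = r * q * k := by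
    intro i
    rw [← hp i, Finset.card_filter, Finset.card_filter, ← aux_sum_tiling hT]
    refine Finset.sum_congr rfl fun K hK => ?_
    rw [← Finset.card_filter]
    split_ifs with hi
    · obtain ⟨x, hx, rfl⟩ := mem_image.mp hi
      symm
      rw [Finset.card_eq_one]
      refine ⟨x, ?_⟩
      ext y
      simp only [mem_filter, mem_singleton]
      constructor
      · rintro ⟨hy, hxy⟩
        exact hinj K hK hy hx hxy
      · rintro rfl
        exact ⟨hx, rfl⟩
    · symm
      rw [Finset.card_eq_zero, Finset.filter_eq_empty_iff]
      intro x hx hxi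
      exact hi (mem_image.mpr ⟨x, hx, hxi⟩)
  have hpair := aux_pairs T (fun K => K.image p) himg _ hmeet
  unfold tilingColorCount
  have hsplit : ∀ K ∈ T, (K.sym2.filter fun e => ¬ e.IsDiag ∧ f e = c).card
      = (∑ v ∈ K, if p v = 0 ∧ g v = c then (r - 1) else 0) +
       ∑ d ∈ (((univ : Finset (Fin (r + 1))).erase 0).sym2.filter fun d => ¬ d.IsDiag).filter
          (fun d => h d = c), if d ∈ (K.image p).sym2 then 1 else 0 := by
    intro K hK
    rw [← aux_cliqueA p g f hf0 K (hcard K hK) (hinj K hK) c,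
      ← aux_cliqueB p h f hf1 K (hinj K hK) c,
      ← Finset.card_filter_add_card_filter_not (s := K.sym2.filter fun e => ¬ e.IsDiag ∧ f e = c)
        (fun e => ∃ u ∈ e, p u = 0), Finset.filter_filter, Finset.filter_filter]
  rw [Finset.sum_congr rfl hsplit, Finset.sum_add_distrib, aux_sum_tiling hT, Finset.sum_comm]
  congr 1
  · rw [← Finset.sum_filter, Finset.sum_const, smul_eq_mul]
  · rw [← smul_eq_mul, ← Finset.sum_const]
    refine Finset.sum_congr rfl fun d hd => ?_
    induction d with
    | _ i j =>
      simp only [mem_filter, Sym2.mk_isDiag_iff] at hd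
      have hh := hpair i j hd.1.2
      rw [← Finset.card_filter]
      simp only [mk_mem_sym2_iff]
      rw [hTcard] at hh
      obtain ⟨s, rfl⟩ : ∃ s, r = s + 1 := ⟨r - 1, by omega⟩
      simp only [Nat.add_sub_cancel]
      have e1 : 2 * ((s + 1) * q * k) = s * q * k + (s + 1 + 1) * q * k := by ring
      omega

lemma aux_edges [DecidableEq V] {q : ℕ} (f : Sym2 V → Fin q) (T : Finset (Finset V)) :
    tilingEdgeCount T = ∑ c, tilingColorCount f T c := by
  unfold tilingEdgeCount tilingColorCount
  rw [Finset.sum_comm]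
  refine Finset.sum_congr rfl fun K _ => ?_
  rw [Finset.card_eq_sum_card_fiberwise (f := f) (t := univ) (by simp)]
  refine Finset.sum_congr rfl fun c _ => ?_
  rw [Finset.filter_filter]

lemma aux_exists_color {r q : ℕ} (p : V → Fin (r + 1)) (g : V → Fin q)
    (h : Sym2 (Fin (r + 1)) → Fin q) :
    ∃ f : Sym2 V → Fin q, (∀ u v, p u = 0 → p v ≠ 0 → f s(u, v) = g u) ∧
      (∀ u v, p u ≠ 0 → p v ≠ 0 → f s(u, v) = h s(p u, p v)) := by
  classical
  refine ⟨fun e => if hx : ∃ u ∈ e, p u = 0 then g hx.choose else h (e.map p), ?_, ?_⟩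
  · intro u v hu hv
    have hx : ∃ w ∈ s(u, v), p w = 0 := ⟨u, by simp, hu⟩
    simp only [dif_pos hx]
    obtain ⟨h1, h2⟩ := hx.choose_spec
    rcases Sym2.mem_iff.mp h1 with h3 | h3
    · rw [h3]
    · rw [h3] at h2
      exact absurd h2 hv
  · intro u v hu hv
    have hx : ¬ ∃ w ∈ s(u, v), p w = 0 := by
      simp [hu, hv]
    simp only [dif_neg hx, Sym2.map_mk]

lemma aux_sum_lt (q b x y : ℕ) (hb : b ≤ q) :
    ∑ c : Fin q, (if (c : ℕ) < b then x else y) = b * x + (q - b) * y := by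
  rw [Fin.sum_univ_eq_sum_range (fun c => if c < b then x else y) q]
  obtain ⟨d, rfl⟩ := Nat.exists_eq_add_of_le hb
  rw [Finset.sum_range_add, Finset.sum_congr rfl (g := fun _ => x)]
  · simp
  · intro i hi
    simp [mem_range.mp hi]

attribute [local instance] Classical.propDecidable

/-- **Lemma.** Let `r ≥ 3`, `2 ≤ q ≤ C(r,2)`, and write `C(r,2) = a·q + b` with `0 ≤ b < q`.
If `b = 0` or `r + b ≥ q`, then there are infinitely many `n` divisible by `r` admitting an
`n`-vertex graph with `δ(G) = (r/(r+1))n` and a `q`-edge-coloring such that every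
`K_r`-tiling has discrepancy `0`. -/
theorem lower_bound_construction_small_q (r q a b : ℕ) (hr : 3 ≤ r)
    (hq1 : 2 ≤ q) (hq2 : q ≤ r * (r - 1) / 2)
    (hab : r * (r - 1) / 2 = a * q + b) (hb : b < q)
    (hcond : b = 0 ∨ q ≤ r + b) (N : ℕ) :
    ∃ n : ℕ, N < n ∧ r ∣ n ∧
      ∃ G : SimpleGraph (Fin n),
        (G.minDegree : ℚ) = (r : ℚ) / (r + 1) * n ∧
        ∃ f : Sym2 (Fin n) → Fin q,
          ∀ T : Finset (Finset (Fin n)), IsKrTiling G r T →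
            ∀ c : Fin q, q * tilingColorCount f T c = tilingEdgeCount T := by
  have hq0 : 0 < q := by omega
  have hr0 : 0 < r := by omega
  set k := N + 1 with hk
  set m := r * q * k with hm
  have hmpos : 0 < m := by positivity
  have hchoose : r.choose 2 = a * q + b := by rw [Nat.choose_two_right, hab]
  -- the parts
  let p : Fin ((r + 1) * m) → Fin (r + 1) := fun v => (finProdFinEquiv.symm v).1
  have hp : ∀ i, (univ.filter fun v => p v = i).card = m := by
    intro i
    refine Eq.trans (Eq.symm ?_) (Finset.card_fin m)
    refine Finset.card_bij (fun j _ => finProdFinEquiv (i, j)) ?_ ?_ ?_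
    · intro j _
      refine mem_filter.mpr ⟨mem_univ _, ?_⟩
      exact congrArg Prod.fst (finProdFinEquiv.symm_apply_apply (i, j))
    · intro j _ j' _ hjj
      simpa using hjj
    · intro v hv
      refine ⟨(finProdFinEquiv.symm v).2, mem_univ _, ?_⟩
      rw [← (mem_filter.mp hv).2]
      exact finProdFinEquiv.apply_symm_apply v
  obtain ⟨h, hh⟩ := aux_exists_fibers hq0
    (((univ : Finset (Fin (r + 1))).erase 0).sym2.filter fun d => ¬ d.IsDiag)
    (fun c => if (c : ℕ) < b then a + 1 else a) (by
      rw [aux_sum_lt q b _ _ hb.le, aux_card_nondiag, Finset.card_erase_of_mem (mem_univ _),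
        Finset.card_univ, Fintype.card_fin, Nat.add_sub_cancel, hchoose]
      obtain ⟨d, rfl⟩ := Nat.exists_eq_add_of_le hb.le
      rw [Nat.add_sub_cancel_left]
      ring)
  obtain ⟨g, hg⟩ := aux_exists_fibers hq0
    (univ.filter fun v => p v = 0)
    (fun c => if (c : ℕ) < b then k * (r + b - q) else k * (r + b)) (by
      rw [aux_sum_lt q b _ _ hb.le, hp, hm]
      rcases hcond with rfl | hc
      · simp; ring
      · obtain ⟨s, hs⟩ := Nat.exists_eq_add_of_le hc
        obtain ⟨d, hd⟩ := Nat.exists_eq_add_of_le hb.le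
        have e1 : r + b - q = s := by omega
        have e2 : q - b = d := by omega
        have e3 : r = d + s := by omega
        rw [e1, e2, hs, e3, hd]
        ring)
  obtain ⟨f, hf0, hf1⟩ := aux_exists_color p g h
  refine ⟨(r + 1) * m, ?_, ?_, SimpleGraph.mk (fun u v => p u ≠ p v) ⟨fun _ _ => Ne.symm⟩
    ⟨fun _ h => h rfl⟩, ?_, f, ?_⟩
  · have : 1 * k ≤ (r * q) * k := Nat.mul_le_mul_right k (by exact Nat.mul_pos hr0 hq0)
    have : m ≤ (r + 1) * m := Nat.le_mul_of_pos_left _ (by omega)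
    omega
  · exact ⟨(r + 1) * (q * k), by rw [hm]; ring⟩
  · have : Nonempty (Fin ((r + 1) * m)) := ⟨⟨0, by positivity⟩⟩
    rw [SimpleGraph.IsRegularOfDegree.minDegree_eq (d := r * m)]
    · push_cast
      field_simp
    · intro v
      rw [SimpleGraph.degree, SimpleGraph.neighborFinset_eq_filter]
      have h1 := Finset.card_filter_add_card_filter_not
        (s := (univ : Finset (Fin ((r + 1) * m)))) (fun u => p u = p v)
      rw [hp, Finset.card_univ, Fintype.card_fin] at h1
      have h2 : (r + 1) * m = m + r * m := by ring
      have h3 : (univ.filter fun u => ¬ p u = p v).card = r * m := by omega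
      rw [← h3]
      congr 1
      ext u
      simp only [mem_filter, mem_univ, true_and, ne_eq]
      exact not_congr eq_comm
  · intro T hT c
    have hconst : ∀ c, tilingColorCount f T c = (r - 1) * k * (r + b + a * q) := by
      intro c
      rw [aux_count hr0 p hp _ (fun u v huv => huv) g h f hf0 hf1 T hT c, hh]
      have hgc := hg c
      rw [Finset.filter_filter] at hgc
      have hgc' : (univ.filter fun v => p v = 0 ∧ g v = c).card
          = if (c : ℕ) < b then k * (r + b - q) else k * (r + b) := by
        rw [← hgc]
      rw [hgc']
      split_ifs with hcb
      · have hc : q ≤ r + b := by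
          rcases hcond with h0 | h0 <;> omega
        obtain ⟨s, hs⟩ := Nat.exists_eq_add_of_le hc
        rw [hs, Nat.add_sub_cancel_left]
        ring
      · ring
    rw [aux_edges f T, hconst c, Finset.sum_congr rfl (fun c _ => hconst c)]
    simp
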